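/- Let A be an even tensor with respect to a diagonal ±1 parity matrix Z ∈ M_D(ℂ). (1) A is a graded normal non-degenerate tensor if and only if: 1 is an eigenvalue of E_A of algebraic multiplicity one, every other eigenvalue λ of E_A satisfies |λ| < 1, and there exist positive definite matrices Φ, ρ ∈ M_D(ℂ) with Σ_j (A^j)† Φ A^j = Φ and Σ_j A^j ρ (A^j)† = ρ. (2) A is a graded normal degenerate tensor if and only if: 1 is an eigenvalue of E_A of algebraic multiplicity two, every other eigenvalue of E_A has modulus strictly less than 1, and there exist linearly independent matrices ρ₁, ρ₂ with Σ_j A^j ρ_i (A^j)† = ρ_i (i = 1,2) and linearly independent matrices Φ₁, Φ₂ with Σ_j (A^j)† Φ_i A^j = Φ_i (i = 1,2), such that ρ₁ and Φ₁ are even (Z ρ₁ Z = ρ₁, Z Φ₁ Z = Φ₁) and positive definite while ρ₂ and Φ₂ are odd (Z ρ₂ Z = −ρ₂, Z Φ₂ Z = −Φ₂). -/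

import Mathlib

open Matrix Kronecker
open scoped ComplexOrder

namespace FQCA

noncomputable section

/-- The sign `(-1)^x` associated with a parity `x ∈ ℤ₂`. -/
def sgn (x : ZMod 2) : ℂ := (-1 : ℂ) ^ x.val

/-- Entrywise complex conjugation of a matrix. -/
def mconj {m n : Type*} (A : Matrix m n ℂ) : Matrix m n ℂ := A.map (starRingEnd ℂ)

/-- A diagonal matrix with diagonal entries `±1`. -/
def IsParityMatrix {ν : Type*} (Z : Matrix ν ν ℂ) : Prop :=
  Z.IsDiag ∧ ∀ α, Z α α = 1 ∨ Z α α = -1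

/-- An even tensor: `Z * A i = (-1)^{|i|} A i * Z`. -/
def EvenTensor {ι ν : Type*} [Fintype ν] (p : ι → ZMod 2)
    (A : ι → Matrix ν ν ℂ) (Z : Matrix ν ν ℂ) : Prop :=
  ∀ i, Z * A i = sgn (p i) • (A i * Z)

/-- The transfer matrix `E_A = Σ_i A^i ⊗ conj (A^i)`. -/
def transfer {ι ν : Type*} [Fintype ι] (A : ι → Matrix ν ν ℂ) :
    Matrix (ν × ν) (ν × ν) ℂ :=
  ∑ i, (A i) ⊗ₖ (mconj (A i))

/-- `P` is the orthogonal projector of a nonzero proper graded invariant subspace for `A`. -/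
def GradedInvariantProj {ι ν : Type*} [Fintype ν] [DecidableEq ν]
    (A : ι → Matrix ν ν ℂ) (Z P : Matrix ν ν ℂ) : Prop :=
  P * P = P ∧ Pᴴ = P ∧ P ≠ 0 ∧ P ≠ 1 ∧ P * Z = Z * P ∧ ∀ i, A i * P = P * (A i * P)

/-- A graded irreducible tensor: no nonzero proper graded invariant subspace. -/
def GradedIrreducible {ι ν : Type*} [Fintype ν] [DecidableEq ν]
    (A : ι → Matrix ν ν ℂ) (Z : Matrix ν ν ℂ) : Prop :=
  ¬ ∃ P, GradedInvariantProj A Z P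

/-- A graded normal tensor, `mult = 1` (non-degenerate) or `2` (degenerate):
graded irreducible, `1` is an eigenvalue of the transfer matrix of algebraic multiplicity
`mult`, and all other eigenvalues have modulus `< 1`. -/
def GradedNormal {ι ν : Type*} [Fintype ι] [Fintype ν] [DecidableEq ν]
    (A : ι → Matrix ν ν ℂ) (Z : Matrix ν ν ℂ) (mult : ℕ) : Prop :=
  GradedIrreducible A Z ∧
  (Matrix.charpoly (transfer A)).rootMultiplicity 1 = mult ∧
  ∀ μ ∈ spectrum ℂ (transfer A), μ ≠ 1 → ‖μ‖ < 1

/-- Graded Canonical Form: `A^i = ⊕ₖ μₖ Aₖ^i` with `Z` block diagonal in the same way and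
every block a graded normal tensor. -/
def GCF {ι ν : Type*} [Fintype ι] [Fintype ν] [DecidableEq ν]
    (p : ι → ZMod 2) (A : ι → Matrix ν ν ℂ) (Z : Matrix ν ν ℂ) : Prop :=
  ∃ (g : ℕ) (Dk : Fin g → ℕ) (e : ν ≃ ((k : Fin g) × Fin (Dk k)))
    (μ : Fin g → ℂ)
    (Ak : (k : Fin g) → ι → Matrix (Fin (Dk k)) (Fin (Dk k)) ℂ)
    (Zk : (k : Fin g) → Matrix (Fin (Dk k)) (Fin (Dk k)) ℂ),
    0 < g ∧
    (∀ i, Matrix.reindex e e (A i) = Matrix.blockDiagonal' (fun k => μ k • Ak k i)) ∧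
    Matrix.reindex e e Z = Matrix.blockDiagonal' Zk ∧
    ∀ k, IsParityMatrix (Zk k) ∧ EvenTensor p (Ak k) (Zk k) ∧
      (GradedNormal (Ak k) (Zk k) 1 ∨ GradedNormal (Ak k) (Zk k) 2)

/-- The coefficient `tr(A^{n₁} ⋯ A^{n_N})` of the fMPS with antiperiodic boundary
conditions generated by the tensor `A`. -/
def mpsCoeff {ι ν : Type*} [Fintype ν] [DecidableEq ν] {N : ℕ}
    (A : ι → Matrix ν ν ℂ) (n : Fin N → ι) : ℂ :=
  ((List.ofFn fun j => A (n j)).prod).trace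

/-- The fermionic sign `σ(n,m) = Σ_{k<j} (|n_j|+|m_j|)·|m_k|` of an fMPO matrix element. -/
def mpoSign {ι : Type*} (p : ι → ZMod 2) {N : ℕ} (n m : Fin N → ι) : ZMod 2 :=
  ∑ jk ∈ Finset.univ.filter (fun jk : Fin N × Fin N => jk.2 < jk.1),
    (p (n jk.1) + p (m jk.1)) * p (m jk.2)

/-- The fMPO with antiperiodic boundary conditions generated by the MPO tensor `U`. -/
def fMPO {ι : Type*} (p : ι → ZMod 2) {ν : Type*} [Fintype ν] [DecidableEq ν]
    (U : ι → ι → Matrix ν ν ℂ) (N : ℕ) :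
    Matrix (Fin N → ι) (Fin N → ι) ℂ :=
  Matrix.of fun n m =>
    sgn (mpoSign p n m) * ((List.ofFn fun j => U (n j) (m j)).prod).trace

/-- The fMPO with periodic boundary conditions generated by the MPO tensor `U`
(parity operator `Z` inserted in the trace). -/
def fMPO_PBC {ι : Type*} (p : ι → ZMod 2) {ν : Type*} [Fintype ν] [DecidableEq ν]
    (Z : Matrix ν ν ℂ) (U : ι → ι → Matrix ν ν ℂ) (N : ℕ) :
    Matrix (Fin N → ι) (Fin N → ι) ℂ :=
  Matrix.of fun n m =>
    sgn (mpoSign p n m) * (Z * (List.ofFn fun j => U (n j) (m j)).prod).trace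

/-- The fermionic blocking sign `τ(n,m) = Σ_{j<l} |m_j|·(|n_l|+|m_l|)`. -/
def blockSign {ι : Type*} (p : ι → ZMod 2) {q : ℕ} (n m : Fin q → ι) : ZMod 2 :=
  ∑ jl ∈ Finset.univ.filter (fun jl : Fin q × Fin q => jl.1 < jl.2),
    p (m jl.1) * (p (n jl.2) + p (m jl.2))

/-- The `q`-fold blocked MPO tensor, with the fermionic blocking signs. -/
def blocked {ι : Type*} (p : ι → ZMod 2) {ν : Type*} [Fintype ν] [DecidableEq ν]
    (U : ι → ι → Matrix ν ν ℂ) (q : ℕ) :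
    (Fin q → ι) → (Fin q → ι) → Matrix ν ν ℂ :=
  fun n m => sgn (blockSign p n m) • ((List.ofFn fun j => U (n j) (m j)).prod)

/-- The right rank `r(U)`: rank of the matrix with entry
`(-1)^{|n||m|} (U^{n,m})_{α,β}` in row `(n,β)` and column `(m,α)`. -/
def rightRank {ι ν : Type*} [Fintype ι] [Fintype ν]
    (p : ι → ZMod 2) (U : ι → ι → Matrix ν ν ℂ) : ℕ :=
  (Matrix.of fun (r c : ι × ν) => sgn (p r.1 * p c.1) * U r.1 c.1 c.2 r.2).rank

/-- The left rank `ℓ(U)`: rank of the matrix with entry `(U^{n,m})_{α,β}`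
in row `(n,α)` and column `(m,β)`. -/
def leftRank {ι ν : Type*} [Fintype ι] [Fintype ν]
    (U : ι → ι → Matrix ν ν ℂ) : ℕ :=
  (Matrix.of fun (r c : ι × ν) => U r.1 c.1 r.2 c.2).rank

/-- The Pauli matrix `σˣ`, indexed by `Bool`. -/
def pauliX : Matrix Bool Bool ℂ := Matrix.of fun a b => if a = b then 0 else 1

/-- The Pauli matrix `σᶻ`, indexed by `Bool`. -/
def pauliZ : Matrix Bool Bool ℂ := Matrix.diagonal (fun b => if b then -1 else 1)

/-- The single-site physical parity matrix `P = diag((-1)^{|i|})`. -/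
def singleP {ι : Type*} [DecidableEq ι] (p : ι → ZMod 2) : Matrix ι ι ℂ :=
  Matrix.diagonal (fun i => sgn (p i))

/-- The parity of the doubled physical index `(n,m)` of an MPO tensor. -/
def doubledP {ι : Type*} (p : ι → ZMod 2) : ι × ι → ZMod 2 :=
  fun nm => p nm.1 + p nm.2

/-- An MPO tensor regarded as a tensor in the doubled physical index. -/
def doubledT {ι ν : Type*} (U : ι → ι → Matrix ν ν ℂ) : ι × ι → Matrix ν ν ℂ :=
  fun nm => U nm.1 nm.2

/-- An MPO tensor rescaled by `c`, regarded as a tensor in the doubled physical index. -/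
def mpoScaled {ι ν : Type*} (c : ℂ) (U : ι → ι → Matrix ν ν ℂ) : ι × ι → Matrix ν ν ℂ :=
  fun nm => c • U nm.1 nm.2

/-- The parity operator `σᶻ ⊗ I` on the bond space `Bool × Fin b`. -/
def ZBP (b : ℕ) : Matrix (Bool × Fin b) (Bool × Fin b) ℂ :=
  pauliZ ⊗ₖ (1 : Matrix (Fin b) (Fin b) ℂ)

/-- Structure of a type II MPO tensor: `U^{n,m} = (σˣ)^{|n|+|m|} ⊗ N^{n,m}`. -/
def TypeIIStruct {d b : ℕ} (p : Fin d → ZMod 2)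
    (U : Fin d → Fin d → Matrix (Bool × Fin b) (Bool × Fin b) ℂ) : Prop :=
  ∃ Nm : Fin d → Fin d → Matrix (Fin b) (Fin b) ℂ,
    ∀ n m', U n m' = (pauliX ^ (p n + p m').val) ⊗ₖ Nm n m'

/-- The parity matrix of the product grading on `q` sites. -/
def bigP {d : ℕ} (p : Fin d → ZMod 2) (q : ℕ) :
    Matrix (Fin q → Fin d) (Fin q → Fin d) ℂ :=
  Matrix.diagonal (fun n => sgn (∑ i, p (n i)))

/-- The Jordan-Wigner embedding at site `j` of a local operator `O` homogeneous of
parity `o`: `P^{|O|} ⊗ ⋯ ⊗ P^{|O|} ⊗ O ⊗ I ⊗ ⋯ ⊗ I`. -/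
def jordanWigner {d N : ℕ} (p : Fin d → ZMod 2) (o : ZMod 2)
    (O : Matrix (Fin d) (Fin d) ℂ) (j : Fin N) :
    Matrix (Fin N → Fin d) (Fin N → Fin d) ℂ :=
  Matrix.of fun n m =>
    (∏ l ∈ Finset.univ.filter (fun l : Fin N => l < j),
      ((singleP p) ^ o.val) (n l) (m l)) *
    O (n j) (m j) *
    (∏ l ∈ Finset.univ.filter (fun l : Fin N => j < l),
      (if n l = m l then (1:ℂ) else 0))

section FixedPoints

open Filter Topology
open scoped MatrixOrder Matrix.Norms.L2Operator

variable {ι ν : Type*} [Fintype ι] [Fintype ν] [DecidableEq ν]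

/-- The completely positive map `X ↦ Σ_j A^j X (A^j)†`. -/
def channel (A : ι → Matrix ν ν ℂ) : Module.End ℂ (Matrix ν ν ℂ) :=
  ∑ j, LinearMap.mulLeft ℂ (A j) ∘ₗ LinearMap.mulRight ℂ (A j)ᴴ

lemma channel_apply (A : ι → Matrix ν ν ℂ) (X : Matrix ν ν ℂ) :
    channel A X = ∑ j, A j * X * (A j)ᴴ := by
  simp [channel, LinearMap.sum_apply, mul_assoc]

lemma toMatrix_channel (A : ι → Matrix ν ν ℂ) :
    LinearMap.toMatrix (Matrix.stdBasis ℂ ν ν) (Matrix.stdBasis ℂ ν ν) (channel A) =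
      transfer A := by
  ext ⟨a, b⟩ ⟨c, e⟩
  have hrepr (X : Matrix ν ν ℂ) : (Matrix.stdBasis ℂ ν ν).repr X (a, b) = X a b := rfl
  rw [LinearMap.toMatrix_apply, hrepr, Matrix.stdBasis_eq_single, channel_apply]
  simp only [transfer, Matrix.sum_apply, kroneckerMap_apply, mconj, map_apply]
  refine Finset.sum_congr rfl fun j _ => ?_
  simp [Matrix.mul_apply, Matrix.single_apply, ite_and]

lemma charpoly_channel (A : ι → Matrix ν ν ℂ) :
    (channel A).charpoly = (transfer A).charpoly := by
  rw [← toMatrix_channel, LinearMap.charpoly_toMatrix]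

lemma spectrum_channel (A : ι → Matrix ν ν ℂ) :
    spectrum ℂ (channel A) = spectrum ℂ (transfer A) := by
  rw [← toMatrix_channel, LinearMap.spectrum_toMatrix]

lemma channel_nonneg (A : ι → Matrix ν ν ℂ) {X : Matrix ν ν ℂ} (hX : 0 ≤ X) :
    0 ≤ channel A X := by
  rw [channel_apply]
  exact Finset.sum_nonneg fun j _ =>
    (hX.posSemidef.mul_mul_conjTranspose_same (A j)).nonneg

lemma channel_mono (A : ι → Matrix ν ν ℂ) {X Y : Matrix ν ν ℂ} (h : X ≤ Y) :
    channel A X ≤ channel A Y := by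
  rw [← sub_nonneg, ← map_sub]
  exact channel_nonneg A (sub_nonneg.mpr h)

lemma channel_conjTranspose (A : ι → Matrix ν ν ℂ) (X : Matrix ν ν ℂ) :
    channel A Xᴴ = (channel A X)ᴴ := by
  simp [channel_apply, conjTranspose_sum, conjTranspose_mul, mul_assoc]

omit [DecidableEq ν] in
/-- A linear equation between values of a Hermiticity-preserving map that only has trivial
Hermitian solutions only has trivial solutions. -/
lemma eq_zero_of_isHermitian_imp {f g : Module.End ℂ (Matrix ν ν ℂ)}
    (hf : ∀ X, f Xᴴ = (f X)ᴴ) (hg : ∀ X, g Xᴴ = (g X)ᴴ)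
    (h : ∀ X, X.IsHermitian → f X = 0 → g X = 0) {X : Matrix ν ν ℂ} (hX : f X = 0) :
    g X = 0 := by
  have h1 := h (X + Xᴴ) (by simp [IsHermitian, add_comm]) (by simp [hf, hX])
  have h2 := h (Complex.I • (X - Xᴴ))
    (by simp [IsHermitian, conjTranspose_smul, ← smul_neg]) (by simp [hf, hX])
  rw [map_smul, smul_eq_zero_iff_right Complex.I_ne_zero, map_sub, hg] at h2
  rw [map_add, hg] at h1
  rw [← sub_eq_zero.mp h2, ← two_smul ℂ] at h1
  simpa using h1

lemma tendsto_pow_zero_of_spectrum {B : Type*} [NormedRing B] [NormedAlgebra ℂ B]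
    [CompleteSpace B] (b : B) (h : ∀ k ∈ spectrum ℂ b, ‖k‖ < 1) :
    Tendsto (fun n : ℕ => b ^ n) atTop (𝓝 0) := by
  rcases subsingleton_or_nontrivial B with hB | hB
  · simpa only [Subsingleton.elim _ (0 : B)] using tendsto_const_nhds
  have hr : spectralRadius ℂ b < (1 : NNReal) :=
    spectrum.spectralRadius_lt_of_forall_lt b fun k hk => by exact_mod_cast h k hk
  obtain ⟨r, hbr, hr1⟩ := ENNReal.lt_iff_exists_nnreal_btwn.mp hr
  rw [tendsto_zero_iff_norm_tendsto_zero]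
  refine squeeze_zero' (Eventually.of_forall fun _ => norm_nonneg _) ?_
    (tendsto_pow_atTop_nhds_zero_of_lt_one r.2 (by exact_mod_cast hr1))
  filter_upwards [(spectrum.pow_nnnorm_pow_one_div_tendsto_nhds_spectralRadius b).eventually_lt_const
    hbr, eventually_gt_atTop 0] with n hn hn0
  have := ENNReal.rpow_le_rpow hn.le (Nat.cast_nonneg (α := ℝ) n)
  rw [← ENNReal.rpow_mul, one_div, inv_mul_cancel₀ (by positivity), ENNReal.rpow_one,
    ENNReal.rpow_natCast] at this
  exact_mod_cast this

lemma tendsto_pow_apply_zero (f : Module.End ℂ (Matrix ν ν ℂ))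
    (h : ∀ k ∈ spectrum ℂ f, ‖k‖ < 1) (X : Matrix ν ν ℂ) :
    Tendsto (fun n : ℕ => (f ^ n) X) atTop (𝓝 0) := by
  let e := Module.End.toContinuousLinearMap (𝕜 := ℂ) (Matrix ν ν ℂ)
  have := tendsto_pow_zero_of_spectrum (e f) (by simpa only [AlgEquiv.spectrum_eq] using h)
  have h2 := ((ContinuousLinearMap.apply ℂ (Matrix ν ν ℂ) X).continuous.tendsto 0).comp this
  simp only [map_zero] at h2
  refine h2.congr fun n => ?_
  simp only [Function.comp_apply, ← map_pow]
  rfl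

lemma exists_pos_smul_le {B V : Matrix ν ν ℂ} (hB : B.PosDef) (hV : V.IsHermitian) :
    ∃ ε : ℝ, 0 < ε ∧ ε • V ≤ B := by
  rcases subsingleton_or_nontrivial (Matrix ν ν ℂ) with hs | hs
  · exact ⟨1, one_pos, (Subsingleton.elim _ _).le⟩
  obtain ⟨r, hr, hrB⟩ := (CFC.exists_pos_algebraMap_le_iff hB.isHermitian.isSelfAdjoint).mpr
    fun x hx => hB.isStrictlyPositive.spectrum_pos hx
  have hVn : V ≤ algebraMap ℝ _ ‖V‖ := IsSelfAdjoint.le_algebraMap_norm_self hV.isSelfAdjoint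
  refine ⟨r / (‖V‖ + 1), by positivity, le_trans ?_ hrB⟩
  calc (r / (‖V‖ + 1)) • V ≤ (r / (‖V‖ + 1)) • algebraMap ℝ (Matrix ν ν ℂ) ‖V‖ :=
        smul_le_smul_of_nonneg_left hVn (by positivity)
    _ = algebraMap ℝ _ (r / (‖V‖ + 1) * ‖V‖) := by
        simp [Algebra.algebraMap_eq_smul_one, smul_smul]
    _ ≤ algebraMap ℝ _ r := by
        apply algebraMap_mono
        rw [div_mul_eq_mul_div, div_le_iff₀ (by positivity)]
        nlinarith [norm_nonneg V]

/-- An Archimedean property of the Löwner order. -/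
lemma nonpos_of_forall_nsmul_le {B F : Matrix ν ν ℂ} (h : ∀ n : ℕ, n • F ≤ B) : F ≤ 0 := by
  have h1 (n : ℕ) : F ≤ (1 / ((n : ℝ) + 1)) • B := by
    have := smul_le_smul_of_nonneg_left (h (n + 1))
      (show (0 : ℝ) ≤ 1 / ((n : ℝ) + 1) by positivity)
    rwa [← Nat.cast_smul_eq_nsmul ℝ, smul_smul, Nat.cast_add_one, one_div,
      inv_mul_cancel₀ (by positivity), one_smul, ← one_div] at this
  have h2 := (tendsto_one_div_add_atTop_nhds_zero_nat (𝕜 := ℝ)).smul_const B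
  rw [zero_smul] at h2
  exact ge_of_tendsto' h2 h1

lemma exists_resolvent_nonneg (A : ι → Matrix ν ν ℂ)
    (hle : ∀ k ∈ spectrum ℂ (channel A), ‖k‖ ≤ 1) {s : ℝ} (hs : 1 < s) :
    ∃ X, 0 ≤ X ∧ s • X - channel A X = 1 := by
  have hs0 : 0 < s := one_pos.trans hs
  have hsC : (s : ℂ) ≠ 0 := by exact_mod_cast hs0.ne'
  have hns : (s : ℂ) ∉ spectrum ℂ (channel A) := fun h => by
    have := hle _ h
    rw [Complex.norm_real, Real.norm_of_nonneg hs0.le] at this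
    linarith
  rw [spectrum.notMem_iff, Module.End.isUnit_iff] at hns
  obtain ⟨X, hX⟩ := hns.2 1
  replace hX : s • X - channel A X = 1 := by simpa using hX
  refine ⟨X, ?_, hX⟩
  let g : Module.End ℂ (Matrix ν ν ℂ) := (s : ℂ)⁻¹ • channel A
  have hgapp (Y : Matrix ν ν ℂ) : g Y = s⁻¹ • channel A Y := by
    rw [← Complex.coe_smul s⁻¹, Complex.ofReal_inv]; rfl
  have hgspec : ∀ k ∈ spectrum ℂ g, ‖k‖ < 1 := fun k hk => by
    have := (spectrum.smul_mem_smul_iff (r := Units.mk0 (s : ℂ) hsC)).mpr hk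
    have h2 : (Units.mk0 (s : ℂ) hsC) • g = channel A := by
      simp [g, Units.smul_def, smul_smul, hsC]
    rw [h2, Units.smul_def] at this
    have := hle _ this
    simp only [Units.val_mk0, smul_eq_mul, norm_mul, Complex.norm_real,
      Real.norm_of_nonneg hs0.le] at this
    by_contra! hk1
    nlinarith
  have hgX : g X ≤ X := by
    rw [hgapp, ← sub_nonneg]
    have : X - s⁻¹ • channel A X = s⁻¹ • (1 : Matrix ν ν ℂ) := by
      rw [← hX, smul_sub, smul_smul, inv_mul_cancel₀ hs0.ne', one_smul]
    rw [this]
    exact smul_nonneg (by positivity) zero_le_one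
  have hn (n : ℕ) : (g ^ n) X ≤ X := by
    induction n with
    | zero => simp
    | succ n ih =>
      rw [pow_succ', Module.End.mul_apply]
      refine le_trans ?_ hgX
      rw [hgapp, hgapp]
      exact smul_le_smul_of_nonneg_left (channel_mono A ih) (by positivity)
  exact le_of_tendsto' (tendsto_pow_apply_zero g hgspec X) hn

lemma fixed_nonpos_of_strict_supersolution (A : ι → Matrix ν ν ℂ) {X V : Matrix ν ν ℂ} {c : ℝ}
    (hc : 0 < c) (hX : 0 ≤ X) (hfX : X - channel A X = c • 1) (hV : V.IsHermitian)
    (hfV : channel A V = V) : V ≤ 0 := by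
  obtain ⟨ε, hε, hεV⟩ := exists_pos_smul_le (PosDef.one (n := ν) (R := ℂ)) hV
  have hεV' : (c * ε) • V ≤ c • (1 : Matrix ν ν ℂ) := by
    rw [mul_smul]
    exact smul_le_smul_of_nonneg_left hεV hc.le
  have hfV' : channel A ((c * ε) • V) = (c * ε) • V := by
    rw [← Complex.coe_smul, map_smul, hfV]
  have h := nonpos_of_forall_nsmul_le (B := X) (F := (c * ε) • V) fun n => by
    induction n with
    | zero => simpa using hX
    | succ n ih =>
      have h1 := channel_mono A ih
      rw [map_nsmul, hfV'] at h1
      rw [succ_nsmul]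
      refine (add_le_add h1 hεV').trans_eq ?_
      rw [← hfX, add_sub_cancel]
  have := smul_le_smul_of_nonneg_left h (show 0 ≤ (c * ε)⁻¹ by positivity)
  rwa [smul_smul, inv_mul_cancel₀ (by positivity), one_smul, smul_zero] at this

/-- Perron–Frobenius: if the spectral radius is the eigenvalue `1`, there is a nonzero
positive semidefinite fixed point. -/
lemma exists_nonneg_fixed (A : ι → Matrix ν ν ℂ) (h1 : 1 ∈ spectrum ℂ (channel A))
    (hle : ∀ k ∈ spectrum ℂ (channel A), ‖k‖ ≤ 1) :
    ∃ ρ, 0 ≤ ρ ∧ ρ ≠ 0 ∧ channel A ρ = ρ := by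
  have : ProperSpace (Matrix ν ν ℂ) := FiniteDimensional.proper ℂ _
  have hcont : Continuous (channel A) := (channel A).continuous_of_finiteDimensional
  let s (m : ℕ) : ℝ := 1 + 1 / ((m : ℝ) + 1)
  have hs (m : ℕ) : 1 < s m := by
    have : (0 : ℝ) < 1 / ((m : ℝ) + 1) := by positivity
    simp only [s]; linarith
  choose X hX0 hX using fun m => exists_resolvent_nonneg A hle (hs m)
  let c (m : ℕ) : ℝ := 1 / (1 + ‖X m‖)
  have hc0 (m : ℕ) : 0 ≤ c m := by positivity
  have hcn (m : ℕ) : c m * (1 + ‖X m‖) = 1 := by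
    simp only [c]; field_simp
  have hmem (m : ℕ) : (c m, c m • X m) ∈
      Metric.closedBall (0 : ℝ) 1 ×ˢ Metric.closedBall (0 : Matrix ν ν ℂ) 1 := by
    have := hcn m
    have h3 := mul_nonneg (hc0 m) (norm_nonneg (X m))
    have h4 := hc0 m
    simp only [Set.mem_prod, mem_closedBall_zero_iff, norm_smul, Real.norm_of_nonneg (hc0 m)]
    constructor <;> nlinarith
  obtain ⟨⟨c', Y⟩, -, φ, hφ, hlim⟩ :=
    ((isCompact_closedBall (0 : ℝ) 1).prod (isCompact_closedBall _ 1)).tendsto_subseq hmem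
  rw [Prod.tendsto_iff] at hlim
  obtain ⟨hlc, hlY⟩ := hlim
  simp only [Function.comp_def] at hlc hlY
  have hY0 : 0 ≤ Y := ge_of_tendsto' hlY fun n => smul_nonneg (hc0 _) (hX0 _)
  have hc' : 0 ≤ c' := ge_of_tendsto' hlc fun n => hc0 _
  have hnorm : c' + ‖Y‖ = 1 := by
    refine tendsto_nhds_unique (hlc.add hlY.norm) (tendsto_const_nhds.congr fun n => ?_)
    rw [norm_smul, Real.norm_of_nonneg (hc0 _), ← hcn (φ n)]
    ring
  have hs1 : Tendsto (fun n => s (φ n)) atTop (𝓝 1) := by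
    have := (tendsto_one_div_add_atTop_nhds_zero_nat (𝕜 := ℝ)).const_add 1
    rw [add_zero] at this
    exact this.comp hφ.tendsto_atTop
  have hfY : Y - channel A Y = c' • 1 := by
    have h2 := (hs1.smul hlY).sub ((hcont.tendsto Y).comp hlY)
    rw [one_smul] at h2
    refine tendsto_nhds_unique h2 ((hlc.smul_const 1).congr fun n => ?_)
    simp only [Function.comp_apply]
    rw [← Complex.coe_smul (c (φ n)) (X (φ n)), map_smul, Complex.coe_smul, Complex.coe_smul,
      smul_comm, ← smul_sub, hX]
  rcases hc'.eq_or_lt with h0 | h0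
  · refine ⟨Y, hY0, ?_, ?_⟩
    · rintro rfl
      simp [← h0] at hnorm
    · rw [← h0, zero_smul, sub_eq_zero] at hfY
      exact hfY.symm
  · exfalso
    obtain ⟨V, hV⟩ := (Module.End.hasEigenvalue_iff_mem_spectrum.mpr h1).exists_hasEigenvector
    refine hV.2 (eq_zero_of_isHermitian_imp (f := channel A - 1) (g := 1) ?_ (fun _ => rfl) ?_
      (by simpa [sub_eq_zero] using hV.apply_eq_smul))
    · intro X
      simp [channel_conjTranspose]
    · intro W hW hfW
      have hfW' : channel A W = W := by simpa [sub_eq_zero] using hfW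
      refine le_antisymm (fixed_nonpos_of_strict_supersolution A h0 hY0 hfY hW hfW') ?_
      have := fixed_nonpos_of_strict_supersolution A h0 hY0 hfY hW.neg (by rw [map_neg, hfW'])
      simpa using this

lemma eq_zero_of_channel_eq_add (A : ι → Matrix ν ν ℂ) {ρ : Matrix ν ν ℂ} (hρ : ρ.PosDef)
    (hfρ : channel A ρ = ρ) {Y : Matrix ν ν ℂ}
    (hY : ((channel A - 1) ^ 2 : Module.End ℂ (Matrix ν ν ℂ)) Y = 0) : (channel A - 1) Y = 0 := by
  have key (Y F : Matrix ν ν ℂ) (hY : Y.IsHermitian) (hYF : channel A Y = Y + F)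
      (hF : channel A F = F) : F ≤ 0 := by
    obtain ⟨ε, hε, hεY⟩ := exists_pos_smul_le hρ hY
    have hn (n : ℕ) : ε • (Y + n • F) ≤ ρ := by
      induction n with
      | zero => simpa using hεY
      | succ n ih =>
        have := channel_mono A ih
        rw [hfρ, ← Complex.coe_smul, map_smul, Complex.coe_smul, map_add, map_nsmul, hYF, hF]
          at this
        rwa [succ_nsmul', ← add_assoc]
    refine nonpos_of_forall_nsmul_le (B := ε⁻¹ • ρ - Y) fun n => ?_
    have := smul_le_smul_of_nonneg_left (hn n) (inv_nonneg.mpr hε.le)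
    rw [smul_smul, inv_mul_cancel₀ hε.ne', one_smul] at this
    rwa [le_sub_iff_add_le, add_comm]
  have hherm (X : Matrix ν ν ℂ) : (channel A - 1) Xᴴ = ((channel A - 1) X)ᴴ := by
    simp [channel_conjTranspose]
  refine eq_zero_of_isHermitian_imp (f := (channel A - 1) ^ 2) ?_ hherm ?_ hY
  · intro X
    rw [pow_two, Module.End.mul_apply, hherm, hherm, Module.End.mul_apply]
  · intro X hX hfX
    rw [pow_two, Module.End.mul_apply] at hfX
    set F := (channel A - 1) X with hFdef
    have hXF : channel A X = X + F := by simp [hFdef]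
    have hF : channel A F = F := by simpa [sub_eq_zero] using hfX
    refine le_antisymm (key X F hX hXF hF) ?_
    have := key (-X) (-F) hX.neg (by rw [map_neg, hXF, neg_add]) (by rw [map_neg, hF])
    simpa using this

lemma finrank_eigenspace_channel (A : ι → Matrix ν ν ℂ) {ρ : Matrix ν ν ℂ} (hρ : ρ.PosDef)
    (hfρ : channel A ρ = ρ) :
    Module.finrank ℂ ((channel A).eigenspace 1) = (transfer A).charpoly.rootMultiplicity 1 := by
  have heq : (channel A).eigenspace 1 = (channel A).maxGenEigenspace 1 := by
    refine le_antisymm ((channel A).genEigenspace_le_maximal 1 1) fun x hx => ?_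
    rw [Module.End.mem_maxGenEigenspace] at hx
    obtain ⟨k, hk⟩ := hx
    rw [one_smul] at hk
    rw [Module.End.mem_eigenspace_iff, one_smul, ← sub_eq_zero]
    change (channel A - 1) x = 0
    induction k with
    | zero => simp_all
    | succ k ih =>
      rcases k with _ | k
      · simpa using hk
      · refine ih ?_
        rw [pow_succ', Module.End.mul_apply]
        refine eq_zero_of_channel_eq_add A hρ hfρ ?_
        rwa [← Module.End.mul_apply, ← pow_add, add_comm 2]
  rw [heq, LinearMap.finrank_maxGenEigenspace_eq, charpoly_channel]

omit [Fintype ν] [DecidableEq ν] in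
lemma IsParityMatrix.isHermitian {Z : Matrix ν ν ℂ} (hZ : IsParityMatrix Z) : Z.IsHermitian := by
  ext a b
  rw [conjTranspose_apply]
  rcases eq_or_ne a b with rfl | h
  · rcases hZ.2 a with h | h <;> simp [h]
  · rw [hZ.1 h, hZ.1 h.symm, star_zero]

lemma IsParityMatrix.mul_self {Z : Matrix ν ν ℂ} (hZ : IsParityMatrix Z) : Z * Z = 1 := by
  have h : Z = diagonal Z.diag := hZ.1.diagonal_diag.symm
  rw [h, diagonal_mul_diagonal, ← diagonal_one]
  congr 1
  ext a
  rcases hZ.2 a with h | h <;> simp [h]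

lemma sgn_mul_self (x : ZMod 2) : sgn x * sgn x = 1 := by
  rw [sgn, ← mul_pow]
  simp

lemma star_sgn (x : ZMod 2) : star (sgn x) = sgn x := by
  simp [sgn]

omit [DecidableEq ν] [Fintype ι] in
lemma EvenTensor.conjTranspose {p : ι → ZMod 2} {A : ι → Matrix ν ν ℂ} {Z : Matrix ν ν ℂ}
    (hA : EvenTensor p A Z) (hZ : Z.IsHermitian) : EvenTensor p (fun i => (A i)ᴴ) Z := by
  intro i
  have h := congrArg Matrix.conjTranspose (hA i)
  rw [conjTranspose_smul, conjTranspose_mul, conjTranspose_mul, hZ.eq, star_sgn] at h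
  rw [h, smul_smul, sgn_mul_self, one_smul]

lemma EvenTensor.channel_conj {p : ι → ZMod 2} {A : ι → Matrix ν ν ℂ} {Z : Matrix ν ν ℂ}
    (hA : EvenTensor p A Z) (hZ : Z.IsHermitian) (X : Matrix ν ν ℂ) :
    channel A (Z * X * Z) = Z * channel A X * Z := by
  rw [channel_apply, channel_apply, Finset.mul_sum, Finset.sum_mul]
  refine Finset.sum_congr rfl fun j _ => ?_
  have h2 : (A j)ᴴ * Z = sgn (p j) • (Z * (A j)ᴴ) := by
    have h := (hA.conjTranspose hZ) j
    simp only at h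
    rw [h, smul_smul, sgn_mul_self, one_smul]
  calc A j * (Z * X * Z) * (A j)ᴴ = (A j * Z) * X * (Z * (A j)ᴴ) := by noncomm_ring
    _ = (sgn (p j) * sgn (p j)) • ((A j * Z) * X * (Z * (A j)ᴴ)) := by
        rw [sgn_mul_self, one_smul]
    _ = (sgn (p j) • (A j * Z)) * X * (sgn (p j) • (Z * (A j)ᴴ)) := by
        simp [smul_smul]
    _ = Z * (A j * X * (A j)ᴴ) * Z := by rw [← hA j, ← h2]; noncomm_ring

omit [Fintype ν] [DecidableEq ν] in
lemma transfer_conjTranspose (A : ι → Matrix ν ν ℂ) :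
    transfer (fun i => (A i)ᴴ) = (transfer A)ᴴ := by
  ext ⟨a, b⟩ ⟨c, e⟩
  simp [transfer, mconj, Matrix.sum_apply, mul_comm]

omit [Fintype ι] in
lemma GradedIrreducible.conjTranspose {A : ι → Matrix ν ν ℂ} {Z : Matrix ν ν ℂ}
    (h : GradedIrreducible A Z) : GradedIrreducible (fun i => (A i)ᴴ) Z := by
  rintro ⟨P, hPP, hPh, hP0, hP1, hPZ, hP⟩
  refine h ⟨1 - P, ?_, ?_, ?_, ?_, ?_, fun i => ?_⟩
  · simp [mul_sub, sub_mul, hPP]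
  · simp [hPh]
  · exact sub_ne_zero.mpr hP1.symm
  · simpa using hP0
  · simp [mul_sub, sub_mul, hPZ]
  · have h1 : P * A i = P * A i * P := by
      simpa [conjTranspose_mul, hPh] using congrArg Matrix.conjTranspose (hP i)
    have h2 : P * (A i * (1 - P)) = 0 := by
      rw [mul_sub, mul_sub, mul_one, ← mul_assoc, ← h1, sub_self]
    rw [sub_mul, one_mul, h2, sub_zero]

lemma GradedNormal.conjTranspose {A : ι → Matrix ν ν ℂ} {Z : Matrix ν ν ℂ} {k : ℕ}
    (h : GradedNormal A Z k) : GradedNormal (fun i => (A i)ᴴ) Z k := by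
  obtain ⟨h1, h2, h3⟩ := h
  refine ⟨h1.conjTranspose, ?_, fun μ hμ hμ1 => ?_⟩
  · have hct : (transfer A)ᴴ = ((transfer A).map (starRingEnd ℂ))ᵀ := rfl
    rw [transfer_conjTranspose, hct, charpoly_transpose, charpoly_map, ← h2]
    conv_lhs => rw [← map_one (starRingEnd ℂ)]
    exact (Polynomial.eq_rootMultiplicity_map (starRingEnd ℂ).injective 1).symm
  · rw [transfer_conjTranspose, ← star_eq_conjTranspose, ← Set.star_mem_star,
      ← spectrum.map_star, star_star] at hμ
    rw [← norm_star]
    exact h3 _ hμ fun h => hμ1 (by simpa using congrArg star h)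

/-- Moore–Penrose type inverse of a Hermitian matrix, obtained by functional calculus. -/
lemma exists_pseudoinverse {ρ : Matrix ν ν ℂ} (hρ : ρ.IsHermitian) :
    ∃ G : Matrix ν ν ℂ, G.IsHermitian ∧ ρ * G = G * ρ ∧ ρ * G * ρ = ρ ∧
      ∀ Z, ρ * Z = Z * ρ → G * Z = Z * G := by
  have hsa : IsSelfAdjoint ρ := hρ
  have hc (f : ℝ → ℝ) : ContinuousOn f (spectrum ℝ ρ) :=
    (Matrix.finite_real_spectrum (A := ρ)).continuousOn f
  have hid : cfc (fun x : ℝ => x) ρ = ρ := cfc_id' ℝ ρ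
  refine ⟨cfc (fun x : ℝ => x⁻¹) ρ, cfc_predicate _ ρ, ?_, ?_,
    fun Z h => (Commute.cfc_real (show Commute ρ Z from h) _).eq⟩
  · exact ((Commute.refl ρ).cfc_real _).eq.symm
  · calc ρ * cfc (fun x : ℝ => x⁻¹) ρ * ρ
        = cfc (fun x : ℝ => x) ρ * cfc (fun x : ℝ => x⁻¹) ρ * cfc (fun x : ℝ => x) ρ := by
          rw [hid]
      _ = cfc (fun x : ℝ => x * x⁻¹ * x) ρ := by
          rw [cfc_mul _ _ ρ (hc _) (hc _), cfc_mul _ _ ρ (hc _) (hc _)]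
      _ = ρ := by simpa only [mul_inv_mul_cancel] using hid

lemma mul_eq_zero_of_mul_mul_conjTranspose {ρ M : Matrix ν ν ℂ} (hρ : 0 ≤ ρ)
    (h : M * ρ * Mᴴ = 0) : M * ρ = 0 := by
  obtain ⟨S, hS⟩ := CStarAlgebra.nonneg_iff_eq_star_mul_self.mp hρ
  rw [star_eq_conjTranspose] at hS
  have hMS : (M * Sᴴ) * (M * Sᴴ)ᴴ = 0 := by
    rw [← h, hS]
    simp only [conjTranspose_mul, conjTranspose_conjTranspose, mul_assoc]
  rw [self_mul_conjTranspose_eq_zero] at hMS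
  rw [hS, ← mul_assoc, hMS, zero_mul]

lemma GradedIrreducible.posDef_of_fixed {A : ι → Matrix ν ν ℂ} {Z : Matrix ν ν ℂ}
    (hZ2 : Z * Z = 1) (h : GradedIrreducible A Z) {ρ : Matrix ν ν ℂ} (hρ : 0 ≤ ρ)
    (hρ0 : ρ ≠ 0) (hfρ : channel A ρ = ρ) (hρZ : Z * ρ * Z = ρ) : ρ.PosDef := by
  obtain ⟨G, hGh, hcomm, hρGρ, hG⟩ := exists_pseudoinverse hρ.posSemidef.isHermitian
  obtain ⟨Q, hQ⟩ : ∃ Q, Q = ρ * G := ⟨_, rfl⟩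
  have hQρ : Q * ρ = ρ := by rw [hQ, hρGρ]
  have hQh : Qᴴ = Q := by
    rw [hQ, conjTranspose_mul, hGh.eq, hρ.posSemidef.isHermitian.eq, hcomm]
  have hρZ' : ρ * Z = Z * ρ := by
    conv_rhs => rw [← hρZ]
    simp only [← mul_assoc, hZ2, one_mul]
  have hGZ : G * Z = Z * G := hG Z hρZ'
  by_contra hnpd
  refine h ⟨Q, ?_, hQh, ?_, ?_, ?_, fun i => ?_⟩
  · conv_lhs => rw [hQ, ← mul_assoc, hρGρ, ← hQ]
  · intro h0
    rw [h0, zero_mul] at hQρ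
    exact hρ0 hQρ.symm
  · intro h1
    refine hnpd (hρ.posSemidef.posDef_iff_isUnit.mpr ?_)
    exact IsUnit.of_mul_eq_one G (hQ ▸ h1)
  · rw [hQ, mul_assoc, hGZ, ← mul_assoc, hρZ', mul_assoc]
  · have hsum : ∑ j, ((1 - Q) * A j) * ρ * ((1 - Q) * A j)ᴴ = 0 := by
      have : ∑ j, ((1 - Q) * A j) * ρ * ((1 - Q) * A j)ᴴ = (1 - Q) * channel A ρ * (1 - Q)ᴴ := by
        rw [channel_apply, Finset.mul_sum, Finset.sum_mul]
        refine Finset.sum_congr rfl fun j _ => ?_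
        simp only [conjTranspose_mul, mul_assoc]
      rw [this, hfρ, sub_mul, one_mul, hQρ, sub_self, zero_mul]
    rw [Finset.sum_eq_zero_iff_of_nonneg fun j _ =>
      (hρ.posSemidef.mul_mul_conjTranspose_same _).nonneg] at hsum
    have hi := hsum i (Finset.mem_univ i)
    have hi' : (1 - Q) * A i * ρ = 0 := mul_eq_zero_of_mul_mul_conjTranspose hρ hi
    have h2 : (1 - Q) * A i * Q = 0 := by
      conv_lhs => enter [2]; rw [hQ]
      rw [← mul_assoc, hi', zero_mul]
    rw [sub_mul, sub_mul, one_mul, sub_eq_zero] at h2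
    rw [← mul_assoc]
    exact h2

lemma GradedIrreducible.exists_real_smul_eq {A : ι → Matrix ν ν ℂ} {Z : Matrix ν ν ℂ}
    (hZ2 : Z * Z = 1) (h : GradedIrreducible A Z) {ρ : Matrix ν ν ℂ} (hρ : ρ.PosDef)
    (hfρ : channel A ρ = ρ) (hρZ : Z * ρ * Z = ρ) {X : Matrix ν ν ℂ} (hX : X.IsHermitian)
    (hfX : channel A X = X) (hXZ : Z * X * Z = X) : ∃ t : ℝ, X = t • ρ := by
  rcases isEmpty_or_nonempty ν with hs | hs
  · exact ⟨0, Subsingleton.elim _ _⟩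
  have hinv {ε : ℝ} {V : Matrix ν ν ℂ} (hε : 0 < ε) (hV : ε • V ≤ ρ) : V ≤ ε⁻¹ • ρ := by
    have := smul_le_smul_of_nonneg_left hV (inv_nonneg.mpr hε.le)
    rwa [smul_smul, inv_mul_cancel₀ hε.ne', one_smul] at this
  obtain ⟨ε₁, hε₁, h1⟩ := exists_pos_smul_le hρ hX
  obtain ⟨ε₂, hε₂, h2⟩ := exists_pos_smul_le hρ hX.neg
  let S : Set ℝ := {t | X ≤ t • ρ}
  have hne : S.Nonempty := ⟨_, hinv hε₁ h1⟩
  have hρ0 : ρ ≠ 0 := fun h0 => not_isUnit_zero (h0 ▸ hρ.isUnit)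
  have hbdd : BddBelow S := by
    refine ⟨-ε₂⁻¹, fun t ht => ?_⟩
    by_contra! hlt
    have h3 := add_le_add ht (hinv hε₂ h2)
    rw [add_neg_cancel, ← add_smul] at h3
    have h4 : (t + ε₂⁻¹) • ρ ≤ 0 :=
      smul_nonpos_of_nonpos_of_nonneg (by linarith) hρ.posSemidef.nonneg
    rcases smul_eq_zero.mp (le_antisymm h4 h3) with h5 | h5
    · linarith
    · exact hρ0 h5
  have hclosed : IsClosed S :=
    isClosed_le continuous_const (continuous_id.smul continuous_const)
  have hmem : sInf S ∈ S := hclosed.csInf_mem hne hbdd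
  refine ⟨sInf S, ?_⟩
  by_contra hneq
  have hpd : (sInf S • ρ - X).PosDef := by
    refine h.posDef_of_fixed hZ2 (sub_nonneg.mpr hmem) (sub_ne_zero.mpr (Ne.symm hneq)) ?_ ?_
    · rw [map_sub, ← Complex.coe_smul, map_smul, hfρ, hfX]
    · rw [mul_sub, sub_mul, hXZ, mul_smul_comm, smul_mul_assoc, hρZ]
  obtain ⟨ε, hε, hle⟩ := exists_pos_smul_le hpd hρ.isHermitian
  have : sInf S - ε ∈ S := by
    change X ≤ (sInf S - ε) • ρ
    rw [sub_smul]
    exact le_sub_comm.mp hle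
  linarith [csInf_le hbdd this]

lemma GradedIrreducible.exists_smul_eq {A : ι → Matrix ν ν ℂ} {Z : Matrix ν ν ℂ}
    (hZh : Z.IsHermitian) (hZ2 : Z * Z = 1) (h : GradedIrreducible A Z) {ρ : Matrix ν ν ℂ}
    (hρ : ρ.PosDef) (hfρ : channel A ρ = ρ) (hρZ : Z * ρ * Z = ρ) {X : Matrix ν ν ℂ}
    (hfX : channel A X = X) (hXZ : Z * X * Z = X) : ∃ c : ℂ, X = c • ρ := by
  have hXZ' : Z * Xᴴ * Z = Xᴴ := by
    simpa [hZh.eq, mul_assoc] using congrArg Matrix.conjTranspose hXZ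
  have hfX' : channel A Xᴴ = Xᴴ := by rw [channel_conjTranspose, hfX]
  obtain ⟨s, hs⟩ := h.exists_real_smul_eq hZ2 hρ hfρ hρZ (X := X + Xᴴ)
    (by simp [IsHermitian, add_comm]) (by rw [map_add, hfX, hfX'])
    (by rw [mul_add, add_mul, hXZ, hXZ'])
  obtain ⟨t, ht⟩ := h.exists_real_smul_eq hZ2 hρ hfρ hρZ (X := Complex.I • (X - Xᴴ))
    (by simp [IsHermitian, conjTranspose_smul, ← smul_neg]) (by rw [map_smul, map_sub, hfX, hfX'])
    (by rw [mul_smul_comm, smul_mul_assoc, mul_sub, sub_mul, hXZ, hXZ'])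
  refine ⟨(1 / 2) * (s - Complex.I * t), ?_⟩
  have h2 : X - Xᴴ = (-Complex.I * t) • ρ := by
    rw [mul_smul, Complex.coe_smul, ← ht, smul_smul]
    simp
  have h3 : X = (1 / 2 : ℂ) • ((X + Xᴴ) + (X - Xᴴ)) := by
    rw [add_add_sub_cancel, ← two_smul ℂ, smul_smul]
    norm_num
  rw [h3, h2, hs, ← Complex.coe_smul, ← add_smul, smul_smul]
  congr 1
  ring

lemma GradedNormal.exists_even_posDef_fixed {p : ι → ZMod 2} {A : ι → Matrix ν ν ℂ}
    {Z : Matrix ν ν ℂ} {k : ℕ} (hZ : IsParityMatrix Z) (hA : EvenTensor p A Z) (hk : k ≠ 0)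
    (h : GradedNormal A Z k) : ∃ ρ, ρ.PosDef ∧ channel A ρ = ρ ∧ Z * ρ * Z = ρ := by
  obtain ⟨hirr, hmult, hspec⟩ := h
  have h1 : 1 ∈ spectrum ℂ (transfer A) := by
    rw [Matrix.mem_spectrum_iff_isRoot_charpoly]
    exact (Polynomial.rootMultiplicity_pos (Matrix.charpoly_monic _).ne_zero).mp (by omega)
  rw [← spectrum_channel] at h1 hspec
  obtain ⟨σ, hσ, hσ0, hfσ⟩ := exists_nonneg_fixed A h1 fun k hk => by
    by_cases hk1 : k = 1
    · simp [hk1]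
    · exact (hspec k hk hk1).le
  have hZh := hZ.isHermitian
  have hZσ : 0 ≤ Z * σ * Z := by
    have := (hσ.posSemidef.mul_mul_conjTranspose_same Z).nonneg
    rwa [hZh.eq] at this
  have hf : channel A (σ + Z * σ * Z) = σ + Z * σ * Z := by
    rw [map_add, hA.channel_conj hZh, hfσ]
  have he : Z * (σ + Z * σ * Z) * Z = σ + Z * σ * Z := by
    have : Z * (σ + Z * σ * Z) * Z = Z * σ * Z + (Z * Z) * σ * (Z * Z) := by noncomm_ring
    rw [this, hZ.mul_self, one_mul, mul_one, add_comm]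
  refine ⟨_, hirr.posDef_of_fixed hZ.mul_self (add_nonneg hσ hZσ) ?_ hf he, hf, he⟩
  intro h0
  exact hσ0 (le_antisymm (by rw [← h0]; exact le_add_of_nonneg_right hZσ) hσ)

lemma GradedNormal.exists_odd_fixed {p : ι → ZMod 2} {A : ι → Matrix ν ν ℂ}
    {Z : Matrix ν ν ℂ} (hZ : IsParityMatrix Z) (hA : EvenTensor p A Z)
    (h : GradedNormal A Z 2) : ∃ ρ, ρ ≠ 0 ∧ channel A ρ = ρ ∧ Z * ρ * Z = -ρ := by
  obtain ⟨ρ, hρ, hfρ, hρZ⟩ := h.exists_even_posDef_fixed hZ hA two_ne_zero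
  have hfin := finrank_eigenspace_channel A hρ hfρ
  rw [h.2.1] at hfin
  obtain ⟨V, hV, hVρ⟩ : ∃ V ∈ (channel A).eigenspace 1, V ∉ Submodule.span ℂ {ρ} := by
    by_contra! hle
    have h1 := Submodule.finrank_mono (show (channel A).eigenspace 1 ≤ Submodule.span ℂ {ρ}
      from hle)
    have h2 := finrank_span_le_card (R := ℂ) ({ρ} : Set (Matrix ν ν ℂ))
    simp at h2
    omega
  rw [Module.End.mem_eigenspace_iff, one_smul] at hV
  refine ⟨V - Z * V * Z, fun h0 => hVρ ?_, ?_, ?_⟩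
  · obtain ⟨c, hc⟩ := h.1.exists_smul_eq hZ.isHermitian hZ.mul_self hρ hfρ hρZ hV
      (sub_eq_zero.mp h0).symm
    exact Submodule.mem_span_singleton.mpr ⟨c, hc.symm⟩
  · rw [map_sub, hA.channel_conj hZ.isHermitian, hV]
  · have : Z * (V - Z * V * Z) * Z = Z * V * Z - (Z * Z) * V * (Z * Z) := by noncomm_ring
    rw [this, hZ.mul_self, one_mul, mul_one, neg_sub]

omit [Fintype ι] [DecidableEq ν] in
lemma linearIndependent_even_odd {Z X Y : Matrix ν ν ℂ} (hX : Z * X * Z = X) (hX0 : X ≠ 0)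
    (hY : Z * Y * Z = -Y) (hY0 : Y ≠ 0) : LinearIndependent ℂ ![X, Y] := by
  rw [LinearIndependent.pair_iff]
  intro a b hab
  have h : a • X - b • Y = 0 := by
    have := congrArg (fun M => Z * M * Z) hab
    simpa [mul_add, add_mul, hX, hY, sub_eq_add_neg] using this
  rw [sub_eq_zero.mp h, ← two_smul ℂ] at hab
  have hb : b = 0 := by simpa [hY0] using hab
  rw [hb, zero_smul, sub_zero] at h
  exact ⟨by simpa [hX0] using h, hb⟩

/-- If every even fixed point is a multiple of an invertible `ρ` and the dual map has a positive
definite fixed point, the tensor is graded irreducible. -/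
lemma gradedIrreducible_of_fixed {p : ι → ZMod 2} {A : ι → Matrix ν ν ℂ}
    {Z : Matrix ν ν ℂ} (hZ : IsParityMatrix Z) (hA : EvenTensor p A Z) {Φ ρ : Matrix ν ν ℂ}
    (hΦ : Φ.PosDef) (hfΦ : ∑ j, (A j)ᴴ * Φ * A j = Φ) (hρ : ρ.PosDef)
    (huniq : ∀ X, channel A X = X → Z * X * Z = X → ∃ c : ℂ, X = c • ρ) :
    GradedIrreducible A Z := by
  rintro ⟨P, hPP, hPh, hP0, hP1, hPZ, hP⟩
  let W : Submodule ℂ (Matrix ν ν ℂ) :=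
    { carrier := {Y | P * Y = Y ∧ Y * P = Y ∧ Z * Y * Z = Y}
      add_mem' := fun {X Y} hX hY => by
        simp_all [mul_add, add_mul]
      zero_mem' := by simp
      smul_mem' := fun c X hX => by simp_all }
  have hW : ∀ Y ∈ W, channel A Y ∈ W := by
    rintro Y ⟨h1, h2, h3⟩
    refine ⟨?_, ?_, by rw [← hA.channel_conj hZ.isHermitian, h3]⟩
    · rw [channel_apply, Finset.mul_sum]
      refine Finset.sum_congr rfl fun j _ => ?_
      calc P * (A j * Y * (A j)ᴴ) = P * (A j * (P * Y) * (A j)ᴴ) := by rw [h1]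
        _ = P * (A j * P) * Y * (A j)ᴴ := by noncomm_ring
        _ = A j * (P * Y) * (A j)ᴴ := by rw [← hP j]; noncomm_ring
        _ = A j * Y * (A j)ᴴ := by rw [h1]
    · rw [channel_apply, Finset.sum_mul]
      refine Finset.sum_congr rfl fun j _ => ?_
      have hj : P * (A j)ᴴ * P = P * (A j)ᴴ := by
        have := congrArg Matrix.conjTranspose (hP j)
        simp only [conjTranspose_mul, hPh] at this
        exact this.symm
      calc A j * Y * (A j)ᴴ * P = A j * (Y * P) * (A j)ᴴ * P := by rw [h2]
        _ = A j * Y * (P * (A j)ᴴ * P) := by noncomm_ring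
        _ = A j * (Y * P) * (A j)ᴴ := by rw [hj]; noncomm_ring
        _ = A j * Y * (A j)ᴴ := by rw [h2]
  have htr (Y : Matrix ν ν ℂ) : (Φ * channel A Y).trace = (Φ * Y).trace := by
    conv_rhs => rw [← hfΦ]
    rw [channel_apply, Finset.mul_sum, Finset.sum_mul, trace_sum, trace_sum]
    refine Finset.sum_congr rfl fun j _ => ?_
    rw [← mul_assoc, trace_mul_comm]
    simp only [mul_assoc]
  have hPW : P ∈ W := ⟨hPP, hPP, by rw [← hPZ, mul_assoc, hZ.mul_self, mul_one]⟩
  let g : Module.End ℂ W := (channel A).restrict hW - 1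
  have hnsurj : ¬ Function.Surjective g := by
    intro hs
    obtain ⟨Y, hY⟩ := hs ⟨P, hPW⟩
    have hY' : channel A Y - Y = P := congrArg Subtype.val hY
    have h0 : (Φ * P).trace = 0 := by rw [← hY', mul_sub, trace_sub, htr, sub_self]
    have h1 : (P * Φ * Pᴴ).trace = 0 := by
      rw [hPh, trace_mul_comm, ← mul_assoc, hPP, trace_mul_comm, h0]
    rw [(hΦ.posSemidef.mul_mul_conjTranspose_same P).trace_eq_zero_iff] at h1
    have h2 := mul_eq_zero_of_mul_mul_conjTranspose hΦ.posSemidef.nonneg h1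
    exact hP0 (hΦ.isUnit.mul_right_cancel (by rw [h2, zero_mul]))
  rw [← LinearMap.injective_iff_surjective, ← LinearMap.ker_eq_bot, Submodule.eq_bot_iff] at hnsurj
  push Not at hnsurj
  obtain ⟨⟨Y, hYW⟩, hYker, hY0⟩ := hnsurj
  have hfY : channel A Y = Y := by
    have := congrArg Subtype.val (LinearMap.mem_ker.mp hYker)
    exact sub_eq_zero.mp this
  obtain ⟨c, rfl⟩ := huniq Y hfY hYW.2.2
  have hc : c ≠ 0 := by
    rintro rfl
    exact hY0 (Subtype.ext (zero_smul ℂ ρ))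
  refine hP1 (hρ.isUnit.mul_right_cancel ?_)
  rw [one_mul]
  exact smul_right_injective _ hc (by simpa using hYW.1)

end FixedPoints

/-- Characterization of graded normal tensors via the spectrum of the
transfer matrix and the existence of (even/odd) positive fixed points of the associated
completely positive maps. -/
theorem graded_normal_iff_fixed_points {d D : ℕ} (p : Fin d → ZMod 2)
    (Z : Matrix (Fin D) (Fin D) ℂ) (hZ : IsParityMatrix Z)
    (A : Fin d → Matrix (Fin D) (Fin D) ℂ) (hA : EvenTensor p A Z) :
    (GradedNormal A Z 1 ↔
      ((Matrix.charpoly (transfer A)).rootMultiplicity 1 = 1 ∧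
        (∀ μ ∈ spectrum ℂ (transfer A), μ ≠ 1 → ‖μ‖ < 1) ∧
        ∃ (Φ ρ : Matrix (Fin D) (Fin D) ℂ), Φ.PosDef ∧ ρ.PosDef ∧
          (∑ j, (A j)ᴴ * Φ * A j) = Φ ∧ (∑ j, A j * ρ * (A j)ᴴ) = ρ)) ∧
    (GradedNormal A Z 2 ↔
      ((Matrix.charpoly (transfer A)).rootMultiplicity 1 = 2 ∧
        (∀ μ ∈ spectrum ℂ (transfer A), μ ≠ 1 → ‖μ‖ < 1) ∧
        ∃ (ρ₁ ρ₂ Φ₁ Φ₂ : Matrix (Fin D) (Fin D) ℂ),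
          LinearIndependent ℂ ![ρ₁, ρ₂] ∧ LinearIndependent ℂ ![Φ₁, Φ₂] ∧
          (∑ j, A j * ρ₁ * (A j)ᴴ) = ρ₁ ∧ (∑ j, A j * ρ₂ * (A j)ᴴ) = ρ₂ ∧
          (∑ j, (A j)ᴴ * Φ₁ * A j) = Φ₁ ∧ (∑ j, (A j)ᴴ * Φ₂ * A j) = Φ₂ ∧
          Z * ρ₁ * Z = ρ₁ ∧ ρ₁.PosDef ∧ Z * Φ₁ * Z = Φ₁ ∧ Φ₁.PosDef ∧
          Z * ρ₂ * Z = -ρ₂ ∧ Z * Φ₂ * Z = -Φ₂)) := by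
  have hZh := hZ.isHermitian
  have hA' := hA.conjTranspose hZh
  have hch (X : Matrix (Fin D) (Fin D) ℂ) : channel A X = ∑ j, A j * X * (A j)ᴴ :=
    channel_apply A X
  have hdual (X : Matrix (Fin D) (Fin D) ℂ) :
      channel (fun j => (A j)ᴴ) X = ∑ j, (A j)ᴴ * X * A j := by
    simp [channel_apply]
  constructor
  · constructor
    · intro h
      obtain ⟨ρ, hρ, hfρ, -⟩ := h.exists_even_posDef_fixed hZ hA one_ne_zero
      obtain ⟨Φ, hΦ, hfΦ, -⟩ := h.conjTranspose.exists_even_posDef_fixed hZ hA' one_ne_zero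
      rw [hch] at hfρ
      rw [hdual] at hfΦ
      exact ⟨h.2.1, h.2.2, Φ, ρ, hΦ, hρ, hfΦ, hfρ⟩
    · rintro ⟨h1, h2, Φ, ρ, hΦ, hρ, hfΦ, hfρ⟩
      refine ⟨gradedIrreducible_of_fixed hZ hA hΦ hfΦ hρ fun X hfX _ => ?_, h1, h2⟩
      rw [← hch] at hfρ
      have hfin := finrank_eigenspace_channel A hρ hfρ
      rw [h1] at hfin
      have hρ0 : ρ ≠ 0 := by
        rintro rfl
        have : Subsingleton (Matrix (Fin D) (Fin D) ℂ) :=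
          subsingleton_of_zero_eq_one (isUnit_zero_iff.mp hρ.isUnit)
        have := Module.finrank_zero_of_subsingleton (R := ℂ) (M := (channel A).eigenspace 1)
        omega
      obtain ⟨c, hc⟩ := (finrank_eq_one_iff_of_nonzero'
        (⟨ρ, by simpa using hfρ⟩ : (channel A).eigenspace 1) (by simpa using hρ0)).mp hfin
        ⟨X, by simpa using hfX⟩
      exact ⟨c, (congrArg Subtype.val hc).symm⟩
  · constructor
    · intro h
      obtain ⟨ρ₁, hρ₁, hfρ₁, hZρ₁⟩ := h.exists_even_posDef_fixed hZ hA two_ne_zero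
      obtain ⟨Φ₁, hΦ₁, hfΦ₁, hZΦ₁⟩ := h.conjTranspose.exists_even_posDef_fixed hZ hA' two_ne_zero
      obtain ⟨ρ₂, hρ₂, hfρ₂, hZρ₂⟩ := h.exists_odd_fixed hZ hA
      obtain ⟨Φ₂, hΦ₂, hfΦ₂, hZΦ₂⟩ := h.conjTranspose.exists_odd_fixed hZ hA'
      have : Nontrivial (Matrix (Fin D) (Fin D) ℂ) := ⟨ρ₂, 0, hρ₂⟩
      rw [hch] at hfρ₁ hfρ₂
      rw [hdual] at hfΦ₁ hfΦ₂
      exact ⟨h.2.1, h.2.2, ρ₁, ρ₂, Φ₁, Φ₂,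
        linearIndependent_even_odd hZρ₁ hρ₁.isUnit.ne_zero hZρ₂ hρ₂,
        linearIndependent_even_odd hZΦ₁ hΦ₁.isUnit.ne_zero hZΦ₂ hΦ₂,
        hfρ₁, hfρ₂, hfΦ₁, hfΦ₂, hZρ₁, hρ₁, hZΦ₁, hΦ₁, hZρ₂, hZΦ₂⟩
    · rintro ⟨h1, h2, ρ₁, ρ₂, Φ₁, Φ₂, hρ, -, hfρ₁, hfρ₂, hfΦ₁, -, hZρ₁, hρ₁, -, hΦ₁, hZρ₂, -⟩
      refine ⟨gradedIrreducible_of_fixed hZ hA hΦ₁ hfΦ₁ hρ₁ fun X hfX hZX => ?_, h1, h2⟩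
      rw [← hch] at hfρ₁ hfρ₂
      have hfin := finrank_eigenspace_channel A hρ₁ hfρ₁
      have hspan : Submodule.span ℂ (Set.range ![ρ₁, ρ₂]) = (channel A).eigenspace 1 := by
        refine Submodule.eq_of_le_of_finrank_le ?_ ?_
        · rw [Submodule.span_le, Set.range_subset_iff]
          intro i
          fin_cases i
          · simpa using hfρ₁
          · simpa using hfρ₂
        · rw [hfin, h1, finrank_span_eq_card hρ, Fintype.card_fin]
      have hX : X ∈ Submodule.span ℂ (Set.range ![ρ₁, ρ₂]) := by
        rw [hspan]
        simpa using hfX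
      rw [Matrix.range_cons, Matrix.range_cons, Matrix.range_empty, Set.union_empty,
        Set.singleton_union, Submodule.mem_span_pair] at hX
      obtain ⟨a, b, rfl⟩ := hX
      have hb : b • ρ₂ = 0 := by
        have : a • ρ₁ - b • ρ₂ = a • ρ₁ + b • ρ₂ := by
          rw [← hZX]
          simp [mul_add, add_mul, hZρ₁, hZρ₂, sub_eq_add_neg]
        have h3 : (2 : ℂ) • b • ρ₂ = 0 := by
          rw [two_smul]
          rw [sub_eq_add_neg, add_right_inj, neg_eq_iff_add_eq_zero] at this
          exact this
        simpa using h3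
      exact ⟨a, by rw [hb, add_zero]⟩
end

end FQCA
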